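/- Let n be a positive integer and let U_1,...,U_n be i.i.d. uniform on (0,1) with order statistics U_(1) ≤ ... ≤ U_(n). Then the Kullback–Leibler divergence between the joint law of the whole ordered sample (U_(1),...,U_(n)) and the product of the marginal laws of U_(1),...,U_(n) equals 2·Σ_{t=2}^{n} T_{t−1} − (n−1)·T_n. -/

import Mathlib

open MeasureTheory Real Filter Topology Classical

noncomputable section

/-- Kullback–Leibler divergence: `∫ log (dP/dQ) dP` when `P ≪ Q`, and `+∞` otherwise. -/
def klDiv {α : Type*} [MeasurableSpace α] (P Q : Measure α) : EReal :=
  if P ≪ Q then ((∫ x, Real.log ((P.rnDeriv Q x).toReal) ∂P : ℝ) : EReal) else ⊤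

/-- The nondecreasing rearrangement of a tuple: `sortTuple x i` is the `i`-th order
statistic (0-indexed) of the vector `x`. -/
def sortTuple {n : ℕ} (x : Fin n → ℝ) : Fin n → ℝ := x ∘ Tuple.sort x

/-- Law of an i.i.d. sample of size `n` from `μ`. -/
def sampleLaw (n : ℕ) (μ : Measure ℝ) : Measure (Fin n → ℝ) := Measure.pi fun _ => μ

/-- Law of the `i`-th order statistic (0-indexed) of an i.i.d. sample of size `n` from `μ`. -/
def osLaw (n : ℕ) (μ : Measure ℝ) (i : Fin n) : Measure ℝ :=
  (sampleLaw n μ).map fun x => sortTuple x i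

/-- Joint law of the order statistics indexed by `I`. -/
def orderLaw (n : ℕ) (μ : Measure ℝ) (I : Finset (Fin n)) : Measure (I → ℝ) :=
  (sampleLaw n μ).map fun x (i : I) => sortTuple x i.1

/-- Product of the marginal laws of the order statistics indexed by `I`. -/
def orderProdLaw (n : ℕ) (μ : Measure ℝ) (I : Finset (Fin n)) : Measure (I → ℝ) :=
  Measure.pi fun i : I => osLaw n μ i.1

/-- Mutual information between two tuples of order statistics. -/
def miTuples (n : ℕ) (μ : Measure ℝ) (I₁ I₂ : Finset (Fin n)) : EReal :=
  klDiv
    ((sampleLaw n μ).map fun x =>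
      ((fun i : I₁ => sortTuple x i.1), (fun i : I₂ => sortTuple x i.1)))
    ((orderLaw n μ I₁).prod (orderLaw n μ I₂))

/-- Mutual information between two single order statistics (0-indexed). -/
def miPair (n : ℕ) (μ : Measure ℝ) (r m : Fin n) : EReal :=
  klDiv ((sampleLaw n μ).map fun x => (sortTuple x r, sortTuple x m))
    ((osLaw n μ r).prod (osLaw n μ m))

/-- The uniform probability measure on `(0,1)`. -/
def unif : Measure ℝ := volume.restrict (Set.Ioo 0 1)

/-- `T r = log (r!) - r * H_r`. -/
def T (r : ℕ) : ℝ := Real.log (Nat.factorial r) - r * (harmonic r : ℝ)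


open Polynomial in
/-- Tail sum of Bernstein polynomials. -/
def tailB (m i : ℕ) : ℝ[X] := ∑ k ∈ Finset.Ico (i+1) (m+2), bernsteinPolynomial ℝ (m+1) k

open Polynomial in
lemma tailB_deriv (m i : ℕ) (hi : i ≤ m) :
    derivative (tailB m i) = (m+1 : ℝ[X]) * bernsteinPolynomial ℝ m i := by
  unfold tailB
  rw [derivative_sum, Finset.sum_Ico_eq_sum_range]
  have h : ∀ k, derivative (bernsteinPolynomial ℝ (m+1) (i+1+k)) =
     (m+1 : ℝ[X]) * bernsteinPolynomial ℝ m (i+k) - (m+1 : ℝ[X]) * bernsteinPolynomial ℝ m (i+(k+1)) := by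
    intro k
    rw [show i+1+k = (i+k)+1 by ring, bernsteinPolynomial.derivative_succ_aux, mul_sub]
    rfl
  simp_rw [h]
  rw [Finset.sum_range_sub']
  rw [bernsteinPolynomial.eq_zero_of_lt (n := m) (ν := i + (m+2-(i+1))) ℝ (by omega)]
  simp

lemma tailB_zero (m i : ℕ) : (tailB m i).eval 0 = 0 := by
  unfold tailB
  rw [Polynomial.eval_finsetSum]
  apply Finset.sum_eq_zero
  intro k hk
  rw [bernsteinPolynomial.eval_at_0, if_neg]
  rw [Finset.mem_Ico] at hk; omega

lemma tailB_one (m i : ℕ) (hi : i ≤ m) : (tailB m i).eval 1 = 1 := by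
  unfold tailB
  rw [Polynomial.eval_finsetSum]
  simp_rw [bernsteinPolynomial.eval_at_1]
  rw [Finset.sum_ite_eq', if_pos]
  rw [Finset.mem_Ico]; omega

/-- density of the i-th order statistic among m+1 -/
noncomputable def dens (m i : ℕ) (u : ℝ) : ℝ := (m+1) * (bernsteinPolynomial ℝ m i).eval u

lemma dens_eq (m i : ℕ) (u : ℝ) : dens m i u = (m+1) * (m.choose i * u^i * (1-u)^(m-i)) := by
  simp [dens, bernsteinPolynomial]

lemma dens_cont (m i : ℕ) : Continuous (dens m i) := by
  unfold dens; fun_prop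

lemma tailB_hasDeriv (m i : ℕ) (hi : i ≤ m) (u : ℝ) :
    HasDerivAt (fun u => (tailB m i).eval u) (dens m i u) u := by
  have := (tailB m i).hasDerivAt u
  rw [tailB_deriv m i hi] at this
  exact this.congr_deriv (by simp [dens])

lemma dens_integral (m i : ℕ) (hi : i ≤ m) (t : ℝ) :
    ∫ u in (0:ℝ)..t, dens m i u = (tailB m i).eval t := by
  rw [intervalIntegral.integral_eq_sub_of_hasDerivAt (fun u _ => tailB_hasDeriv m i hi u)
    ((dens_cont m i).intervalIntegrable _ _), tailB_zero, sub_zero]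

lemma dens_pos (m i : ℕ) (hi : i ≤ m) (u : ℝ) (hu : u ∈ Set.Ioo (0:ℝ) 1) : 0 < dens m i u := by
  rw [dens_eq]
  have h1 := hu.1
  have h2 : 0 < 1 - u := by linarith [hu.2]
  have := Nat.choose_pos hi
  positivity

lemma log_dens (m i : ℕ) (hi : i ≤ m) (u : ℝ) (hu : u ∈ Set.Ioo (0:ℝ) 1) :
    Real.log (dens m i u) = Real.log ((m+1) * m.choose i) + i * Real.log u + (m-i : ℕ) * Real.log (1-u) := by
  rw [dens_eq]
  have h1 := hu.1
  have h2 : 0 < 1 - u := by linarith [hu.2]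
  have := Nat.choose_pos hi
  rw [← mul_assoc, ← mul_assoc, Real.log_mul (by positivity) (by positivity), Real.log_mul (by positivity) (by positivity), Real.log_pow, Real.log_pow]

open Polynomial in
lemma ibp (q : ℝ[X]) :
    ∫ u in (0:ℝ)..1, (derivative (X * q)).eval u * Real.log u = - ∫ u in (0:ℝ)..1, q.eval u := by
  have hI1 : IntervalIntegrable (fun u => (derivative (X * q)).eval u * Real.log u) volume 0 1 :=
    intervalIntegral.intervalIntegrable_log'.continuousOn_mul (by fun_prop)
  have hI2 : IntervalIntegrable (fun u => q.eval u) volume 0 1 :=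
    Continuous.intervalIntegrable (by fun_prop) _ _
  have := intervalIntegral.integral_eq_sub_of_hasDerivAt_of_le (a := 0) (b := 1)
    (f := fun u => q.eval u * (u * Real.log u))
    (f' := fun u => (derivative (X * q)).eval u * Real.log u + q.eval u) zero_le_one
    (by
      have := Real.continuous_mul_log
      fun_prop) (by
      intro u hu
      have hu0 : u ≠ 0 := hu.1.ne'
      have := ((X * q).hasDerivAt u).mul (Real.hasDerivAt_log hu0)
      refine (this.congr_deriv ?_).congr_of_eventuallyEq ?_
      · simp; field_simp
      · filter_upwards with x
        simp; ring) (hI1.add hI2)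
  rw [intervalIntegral.integral_add hI1 hI2] at this
  simp at this
  simp
  linarith

lemma bern_div (m k : ℕ) :
    bernsteinPolynomial ℝ (m+1) (k+1) = Polynomial.X * (Polynomial.C (1/(k+1:ℝ)) * ((m+1 : Polynomial ℝ) * bernsteinPolynomial ℝ m k)) := by
  unfold bernsteinPolynomial
  have h : ((m+1).choose (k+1) : ℝ) = (1/(k+1:ℝ)) * ((m+1) * m.choose k) := by
    have := Nat.add_one_mul_choose_eq m k
    have h2 : ((m:ℝ)+1) * m.choose k = (m+1).choose (k+1) * (k+1) := by exact_mod_cast this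
    rw [h2]; field_simp
  have h' : ((m+1).choose (k+1) : Polynomial ℝ) = Polynomial.C (1/(k+1:ℝ)) * ((m+1) * m.choose k) := by
    rw [← Polynomial.C_eq_natCast, h]; simp
  rw [h', show m + 1 - (k+1) = m - k by omega]
  ring

lemma dens_log (m i : ℕ) (hi : i ≤ m) :
    ∫ u in (0:ℝ)..1, dens m i u * Real.log u = (harmonic i : ℝ) - harmonic (m+1) := by
  set q : Polynomial ℝ := ∑ k ∈ Finset.Ico i (m+1), (Polynomial.C (1/(k+1:ℝ)) * ((m+1 : Polynomial ℝ) * bernsteinPolynomial ℝ m k)) with hq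
  have h1 : tailB m i = Polynomial.X * q := by
    rw [hq, Finset.mul_sum, tailB, ← Finset.sum_Ico_add' _ i (m+1) 1]
    exact Finset.sum_congr rfl fun k _ => bern_div m k
  have h2 := ibp q
  rw [← h1, tailB_deriv m i hi] at h2
  have h3 : ∀ u, Polynomial.eval u ((m+1 : Polynomial ℝ) * bernsteinPolynomial ℝ m i) = dens m i u := by
    intro u; simp [dens]
  simp_rw [h3] at h2
  rw [h2]
  have h4 : ∀ u, q.eval u = ∑ k ∈ Finset.Ico i (m+1), (1/(k+1:ℝ)) * dens m k u := by
    intro u; simp [hq, Polynomial.eval_finsetSum, dens]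
  simp_rw [h4]
  rw [intervalIntegral.integral_finsetSum (fun k _ => ((dens_cont m k).const_mul _ |>.intervalIntegrable _ _))]
  have h5 : ∀ k ∈ Finset.Ico i (m+1), ∫ u in (0:ℝ)..1, (1/(k+1:ℝ)) * dens m k u = 1/(k+1:ℝ) := by
    intro k hk
    rw [Finset.mem_Ico] at hk
    rw [intervalIntegral.integral_const_mul, dens_integral m k (by omega), tailB_one m k (by omega), mul_one]
  rw [Finset.sum_congr rfl h5]
  simp only [harmonic]
  push_cast
  rw [Finset.sum_Ico_eq_sub _ (by omega : i ≤ m+1)]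
  simp

lemma dens_flip (m i : ℕ) (hi : i ≤ m) (u : ℝ) : dens m i (1-u) = dens m (m-i) u := by
  rw [dens_eq, dens_eq, Nat.choose_symm hi, Nat.sub_sub_self hi]; ring

lemma dens_log' (m i : ℕ) (hi : i ≤ m) :
    ∫ u in (0:ℝ)..1, dens m i u * Real.log (1-u) = (harmonic (m-i) : ℝ) - harmonic (m+1) := by
  rw [← dens_log m (m-i) (by omega)]
  have := intervalIntegral.integral_comp_sub_left (a := 0) (b := 1) (fun u => dens m i u * Real.log (1-u)) 1
  simp at this
  rw [← this]
  simp_rw [dens_flip m i hi]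

instance unif_prob : IsProbabilityMeasure unif := by
  constructor; simp [unif]

instance sample_prob (n : ℕ) : IsProbabilityMeasure (sampleLaw n unif) := by
  unfold sampleLaw; infer_instance

/-- The box of vectors whose coordinates at most `t` are exactly those in `S`. -/
def box {n : ℕ} (t : ℝ) (S : Finset (Fin n)) : Set (Fin n → ℝ) :=
  Set.pi Set.univ fun j => if j ∈ S then Set.Iic t else Set.Ioi t

lemma mem_box {n : ℕ} (t : ℝ) (S : Finset (Fin n)) (x : Fin n → ℝ) :
    x ∈ box t S ↔ Finset.univ.filter (fun j => x j ≤ t) = S := by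
  simp only [box, Set.mem_pi, Set.mem_univ, true_imp_iff, Finset.ext_iff, Finset.mem_filter,
    Finset.mem_univ, true_and]
  refine forall_congr' fun j => ?_
  by_cases h : j ∈ S <;> simp [h]

lemma measurableSet_box {n : ℕ} (t : ℝ) (S : Finset (Fin n)) : MeasurableSet (box t S) := by
  unfold box
  refine MeasurableSet.univ_pi fun j => ?_
  split_ifs <;> measurability

lemma sort_le_iff {n : ℕ} (x : Fin n → ℝ) (i : Fin n) (t : ℝ) :
    sortTuple x i ≤ t ↔ (i : ℕ) < (Finset.univ.filter (fun j => x j ≤ t)).card := by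
  have h := Tuple.lt_card_le_iff_apply_le_of_monotone (f := sortTuple x) (a := t) (j := i)
    (Tuple.monotone_sort x)
  rw [← h]
  have : (Finset.univ.filter (fun j => x j ≤ t)).card
      = (Finset.univ.filter (fun j => sortTuple x j ≤ t)).card := by
    symm
    apply Finset.card_bij (fun j _ => Tuple.sort x j)
    · intro a ha
      rw [Finset.mem_filter] at ha ⊢
      exact ⟨Finset.mem_univ _, ha.2⟩
    · intro a _ b _ h; exact (Tuple.sort x).injective h
    · intro b hb
      refine ⟨(Tuple.sort x).symm b, ?_, by simp⟩
      rw [Finset.mem_filter] at hb ⊢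
      exact ⟨Finset.mem_univ _, by simpa [sortTuple] using hb.2⟩
  rw [this]

lemma sort_le_set {n : ℕ} (i : Fin n) (t : ℝ) :
    {x : Fin n → ℝ | sortTuple x i ≤ t} =
      ⋃ S ∈ Finset.univ.filter (fun S : Finset (Fin n) => (i:ℕ) < S.card), box t S := by
  ext x
  simp only [Set.mem_ofPred_eq, sort_le_iff, Set.mem_iUnion, mem_box, Finset.mem_filter,
    Finset.mem_univ, true_and]
  simp

lemma measurable_sort {n : ℕ} : Measurable (sortTuple : (Fin n → ℝ) → Fin n → ℝ) := by
  refine measurable_pi_iff.2 fun i => measurable_of_Iic fun t => ?_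
  change MeasurableSet {x : Fin n → ℝ | sortTuple x i ≤ t}
  rw [sort_le_set]
  exact Finset.measurableSet_biUnion _ fun S _ => measurableSet_box t S

instance os_prob (n : ℕ) (i : Fin n) : IsProbabilityMeasure (osLaw n unif i) :=
  Measure.isProbabilityMeasure_map (measurable_pi_iff.1 measurable_sort i).aemeasurable

lemma sample_box {n : ℕ} (t : ℝ) (ht0 : 0 ≤ t) (ht1 : t ≤ 1) (S : Finset (Fin n)) :
    (sampleLaw n unif).real (box t S) = t ^ S.card * (1-t)^(n - S.card) := by
  have h1 : unif.real (Set.Iic t) = t := by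
    rw [unif, measureReal_restrict_apply measurableSet_Iic]
    rcases ht1.eq_or_lt with rfl | h
    · rw [show Set.Iic (1:ℝ) ∩ Set.Ioo 0 1 = Set.Ioo 0 1 by
        ext x; simp; intro _ h; exact h.le]
      simp
    · rw [show Set.Iic t ∩ Set.Ioo 0 1 = Set.Ioc 0 t by
        ext x; simp; constructor
        · rintro ⟨a, b, c⟩; exact ⟨b, a⟩
        · rintro ⟨a, b⟩; exact ⟨b, a, by linarith⟩]
      simp [ht0]
  have h2 : unif.real (Set.Ioi t) = 1 - t := by
    rw [← Set.compl_Iic, measureReal_compl measurableSet_Iic, h1]; simp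
  rw [box, sampleLaw, Measure.real, Measure.pi_pi, ENNReal.toReal_prod]
  have : ∀ j, (unif (if j ∈ S then Set.Iic t else Set.Ioi t)).toReal = if j ∈ S then t else 1 - t := by
    intro j
    split_ifs
    · exact h1
    · exact h2
  simp_rw [this]
  rw [Finset.prod_ite]
  simp only [Finset.prod_const, Finset.filter_univ_mem]
  congr 2
  rw [Finset.filter_not, Finset.filter_univ_mem, ← Finset.compl_eq_univ_sdiff, Finset.card_compl,
    Fintype.card_fin]

lemma os_cdf (m : ℕ) (i : Fin (m+1)) (t : ℝ) (ht0 : 0 ≤ t) (ht1 : t ≤ 1) :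
    (osLaw (m+1) unif i).real (Set.Iic t) = (tailB m i).eval t := by
  rw [osLaw, map_measureReal_apply (measurable_pi_iff.1 measurable_sort i) measurableSet_Iic]
  change (sampleLaw (m+1) unif).real {x | sortTuple x i ≤ t} = _
  rw [sort_le_set, measureReal_biUnion_finset]
  · simp_rw [sample_box t ht0 ht1]
    rw [Finset.sum_filter, ← Finset.powerset_univ,
      Finset.sum_powerset_apply_card (fun k => if (i:ℕ) < k then t^k * (1-t)^(m+1-k) else 0)]
    simp only [Finset.card_univ, Fintype.card_fin, smul_ite, smul_zero]
    rw [← Finset.sum_filter, tailB, Polynomial.eval_finsetSum]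
    apply Finset.sum_congr
    · ext k; simp; omega
    · intro k _
      simp [bernsteinPolynomial, mul_assoc]
  · intro S _ S' _ hne
    refine Set.disjoint_left.2 fun x h h' => hne ?_
    rw [mem_box] at h h'
    rw [← h, ← h']
  · intro S _; exact measurableSet_box t S

lemma dens_nonneg (m i : ℕ) (_hi : i ≤ m) (u : ℝ) (hu : u ∈ Set.Icc (0:ℝ) 1) : 0 ≤ dens m i u := by
  rw [dens_eq]
  have h1 := hu.1
  have h2 : 0 ≤ 1 - u := by linarith [hu.2]
  positivity

lemma unif_ae : ∀ᵐ u ∂unif, u ∈ Set.Ioo (0:ℝ) 1 := ae_restrict_mem measurableSet_Ioo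

lemma dens_meas (m i : ℕ) : Measurable (fun u => ENNReal.ofReal (dens m i u)) :=
  ENNReal.measurable_ofReal.comp (dens_cont m i).measurable

lemma dens_Iic (m i : ℕ) (hi : i ≤ m) (t : ℝ) (ht0 : 0 ≤ t) (ht1 : t ≤ 1) :
    (unif.withDensity fun u => ENNReal.ofReal (dens m i u)) (Set.Iic t) =
      ENNReal.ofReal ((tailB m i).eval t) := by
  rw [withDensity_apply _ measurableSet_Iic, ← dens_integral m i hi,
    intervalIntegral.integral_of_le ht0, ofReal_integral_eq_lintegral_ofReal, unif,
    Measure.restrict_restrict measurableSet_Iic]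
  · refine setLIntegral_congr ?_
    have : (Set.Iic t ∩ Set.Ioo 0 1 : Set ℝ) =ᵐ[volume] (Set.Iic t ∩ Set.Ioc 0 1 : Set ℝ) :=
      Filter.EventuallyEq.inter (ae_eq_refl _) Ioo_ae_eq_Ioc
    have hs : (Set.Iic t ∩ Set.Ioc 0 1 : Set ℝ) = Set.Ioc 0 t := by
      ext x
      simp only [Set.mem_inter_iff, Set.mem_Iic, Set.mem_Ioc]
      constructor
      · rintro ⟨a, b, c⟩; exact ⟨b, a⟩
      · rintro ⟨a, b⟩; exact ⟨b, a, by linarith⟩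
    rw [hs] at this
    exact this
  · exact ((dens_cont m i).intervalIntegrable 0 t).1
  · filter_upwards [ae_restrict_mem measurableSet_Ioc] with u hu
    exact dens_nonneg m i hi u ⟨hu.1.le, hu.2.trans ht1⟩

instance dens_prob (m : ℕ) (i : Fin (m+1)) :
    IsProbabilityMeasure (unif.withDensity fun u => ENNReal.ofReal (dens m i u)) := by
  constructor
  have h : (unif.withDensity fun u => ENNReal.ofReal (dens m i u)) (Set.Iic 1)ᶜ = 0 := by
    apply withDensity_absolutelyContinuous
    rw [← mem_ae_iff]
    filter_upwards [unif_ae] with u hu using hu.2.le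
  have h2 := dens_Iic m i (by omega) 1 zero_le_one le_rfl
  rw [tailB_one m i (by omega), ENNReal.ofReal_one] at h2
  rw [← measure_add_measure_compl (s := Set.Iic (1:ℝ)) measurableSet_Iic, h, h2, add_zero]

lemma os_eq (m : ℕ) (i : Fin (m+1)) :
    osLaw (m+1) unif i = unif.withDensity fun u => ENNReal.ofReal (dens m i u) := by
  have key : ∀ t : ℝ, 0 ≤ t → t ≤ 1 → osLaw (m+1) unif i (Set.Iic t) =
      (unif.withDensity fun u => ENNReal.ofReal (dens m i u)) (Set.Iic t) := by
    intro t h0 h1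
    rw [dens_Iic m i (by omega) t h0 h1, ← os_cdf m i t h0 h1, ofReal_measureReal]
  refine Measure.ext_of_Iic _ _ fun t => ?_
  rcases lt_or_ge t 0 with h | h
  · have h0 := key 0 le_rfl zero_le_one
    rw [dens_Iic m i (by omega) 0 le_rfl zero_le_one, tailB_zero, ENNReal.ofReal_zero] at h0
    have h1 := key 0 le_rfl zero_le_one
    rw [h0] at h1
    rw [measure_mono_null (Set.Iic_subset_Iic.2 h.le) h0,
      measure_mono_null (Set.Iic_subset_Iic.2 h.le) h1.symm]
  · rcases le_or_gt t 1 with h' | h'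
    · exact key t h h'
    · have h0 := key 1 zero_le_one le_rfl
      have h1 := h0
      rw [dens_Iic m i (by omega) 1 zero_le_one le_rfl, tailB_one m i (by omega), ENNReal.ofReal_one] at h0
      rw [h0] at h1
      rw [le_antisymm prob_le_one (h0.symm.le.trans (measure_mono (Set.Iic_subset_Iic.2 h'.le))),
        le_antisymm prob_le_one (h1.le.trans (measure_mono (Set.Iic_subset_Iic.2 h'.le)))]

lemma pi_dens (m : ℕ) (g : Fin m → ℝ → ENNReal) (hg : ∀ i, Measurable (g i))
    [∀ i, IsProbabilityMeasure (unif.withDensity (g i))] :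
    (Measure.pi fun i => unif.withDensity (g i)) =
      (sampleLaw m unif).withDensity (fun x => ∏ i, g i (x i)) := by
  refine Measure.pi_eq fun s hs => ?_
  rw [withDensity_apply _ (MeasurableSet.univ_pi hs), ← lintegral_indicator (MeasurableSet.univ_pi hs)]
  have h1 : ∀ x : Fin m → ℝ, (Set.univ.pi s).indicator (fun x => ∏ i, g i (x i)) x
      = ∏ i, (s i).indicator (g i) (x i) := by
    intro x
    by_cases hx : x ∈ Set.univ.pi s
    · rw [Set.indicator_of_mem hx]
      refine Finset.prod_congr rfl fun i _ => ?_
      rw [Set.indicator_of_mem (hx i trivial)]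
    · rw [Set.indicator_of_notMem hx]
      simp only [Set.mem_pi, Set.mem_univ, true_imp_iff, not_forall] at hx
      obtain ⟨i, hi⟩ := hx
      rw [Finset.prod_eq_zero (Finset.mem_univ i) (Set.indicator_of_notMem hi _)]
  simp_rw [h1]
  have hm : ∀ i, Measurable ((s i).indicator (g i)) := fun i => (hg i).indicator (hs i)
  rw [sampleLaw, ProbabilityTheory.lintegral_prod_eq_prod_lintegral_of_indepFun Finset.univ
    (fun i (x : Fin m → ℝ) => (s i).indicator (g i) (x i))
    (ProbabilityTheory.iIndepFun_pi fun i => (hm i).aemeasurable)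
    (fun i => (hm i).comp (measurable_pi_apply i))]
  refine Finset.prod_congr rfl fun i _ => ?_
  rw [withDensity_apply _ (hs i), ← lintegral_indicator (hs i)]
  exact (measurePreserving_eval (fun _ : Fin m => unif) i).lintegral_comp (hm i)

lemma sample_ae_inj (n : ℕ) : ∀ᵐ x ∂(sampleLaw n unif), Function.Injective x := by
  have hac : sampleLaw n unif ≪ (volume : Measure (Fin n → ℝ)) := by
    rw [sampleLaw]; unfold unif
    rw [← Measure.restrict_pi_pi]
    exact Measure.restrict_le_self.absolutelyContinuous
  apply hac.ae_le
  have h : ∀ i j : Fin n, i ≠ j → ∀ᵐ x : Fin n → ℝ, x i ≠ x j := by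
    intro i j hij
    let p : Submodule ℝ (Fin n → ℝ) :=
      LinearMap.ker ((LinearMap.proj i : (Fin n → ℝ) →ₗ[ℝ] ℝ) - (LinearMap.proj j : (Fin n → ℝ) →ₗ[ℝ] ℝ))
    have hp : p ≠ ⊤ := by
      intro h
      have : Pi.single i (1:ℝ) ∈ p := by rw [h]; trivial
      simp [p, hij] at this
    have := Measure.addHaar_submodule (volume : Measure (Fin n → ℝ)) p hp
    rw [ae_iff]
    refine measure_mono_null ?_ this
    intro x hx
    have hx' : x i = x j := not_not.1 hx
    simp [p, hx']
  have h' : ∀ᵐ x : Fin n → ℝ, ∀ i j : Fin n, i ≠ j → x i ≠ x j := by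
    simp only [eventually_all]
    exact h
  filter_upwards [h'] with x hx i j hij
  by_contra hne
  exact hx i j hne hij

/-- monotone vectors -/
def monoSet (n : ℕ) : Set (Fin n → ℝ) := {x | Monotone x}

lemma monoSet_meas (n : ℕ) : MeasurableSet (monoSet n) := by
  have : monoSet n = ⋂ i, ⋂ j, ⋂ _ : i ≤ j, {x : Fin n → ℝ | x i ≤ x j} := by
    ext x
    simp only [monoSet, Set.mem_iInter]
    exact Iff.rfl
  rw [this]
  refine MeasurableSet.iInter fun i => MeasurableSet.iInter fun j => MeasurableSet.iInter fun _ => ?_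
  exact measurableSet_le (measurable_pi_apply i) (measurable_pi_apply j)

lemma perm_mp (n : ℕ) (σ : Equiv.Perm (Fin n)) :
    MeasurePreserving (fun x : Fin n → ℝ => x ∘ σ) (sampleLaw n unif) (sampleLaw n unif) := by
  have h := measurePreserving_piCongrLeft (fun _ : Fin n => unif) σ.symm
  unfold sampleLaw
  convert h using 1
  ext x i
  have := MeasurableEquiv.piCongrLeft_apply_apply σ.symm (β := fun _ => ℝ) x (σ i)
  simp at this
  exact this.symm

lemma joint_eq (n : ℕ) : (sampleLaw n unif).map sortTuple =
    (sampleLaw n unif).withDensity ((monoSet n).indicator fun _ => (n.factorial : ENNReal)) := by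
  refine Measure.ext fun A hA => ?_
  rw [Measure.map_apply measurable_sort hA, withDensity_apply _ hA,
    lintegral_indicator (monoSet_meas n), Measure.restrict_restrict (monoSet_meas n),
    lintegral_const, Measure.restrict_apply_univ]
  rw [← lintegral_indicator_one (measurable_sort hA)]
  have hB : MeasurableSet (monoSet n ∩ A) := (monoSet_meas n).inter hA
  have h1 : ∀ᵐ x ∂(sampleLaw n unif), (sortTuple ⁻¹' A).indicator (1 : (Fin n → ℝ) → ENNReal) x =
      ∑ σ : Equiv.Perm (Fin n), (monoSet n ∩ A).indicator (1 : (Fin n → ℝ) → ENNReal) (x ∘ σ) := by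
    filter_upwards [sample_ae_inj n] with x hx
    rw [Finset.sum_eq_single (Tuple.sort x)]
    · have : x ∘ Tuple.sort x ∈ monoSet n := Tuple.monotone_sort x
      by_cases h : sortTuple x ∈ A
      · rw [Set.indicator_of_mem (by exact h), Set.indicator_of_mem (by exact ⟨this, h⟩)]; rfl
      · rw [Set.indicator_of_notMem (by exact h), Set.indicator_of_notMem (fun h' => h h'.2)]
    · intro σ _ hne
      apply Set.indicator_of_notMem
      rintro ⟨h, _⟩
      have := Tuple.unique_monotone (f := x) (σ := σ) h (Tuple.monotone_sort x)
      apply hne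
      ext i
      exact congrArg _ (hx (congrFun this i))
    · intro h; exact absurd (Finset.mem_univ _) h
  rw [lintegral_congr_ae h1, lintegral_finsetSum]
  · have : ∀ σ : Equiv.Perm (Fin n), ∫⁻ x, (monoSet n ∩ A).indicator (1 : (Fin n → ℝ) → ENNReal) (x ∘ σ) ∂(sampleLaw n unif)
      = sampleLaw n unif (monoSet n ∩ A) := by
      intro σ
      rw [(perm_mp n σ).lintegral_comp (f := (monoSet n ∩ A).indicator (1 : (Fin n → ℝ) → ENNReal)) (measurable_one.indicator hB),
        lintegral_indicator_one hB]
    simp_rw [this]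
    simp [Fintype.card_perm]
  · intro σ _
    exact (measurable_one.indicator hB).comp (perm_mp n σ).measurable

lemma log_ii : IntervalIntegrable (fun u => Real.log (1-u)) volume 0 1 := by
  have := (intervalIntegral.intervalIntegrable_log' (a := 0) (b := 1)).comp_sub_left 1
  simpa using this.symm

lemma dens_log_int (m i : ℕ) :
    IntervalIntegrable (fun u => dens m i u * Real.log u) volume 0 1 :=
  intervalIntegral.intervalIntegrable_log'.continuousOn_mul (dens_cont m i).continuousOn

lemma dens_log_int' (m i : ℕ) :
    IntervalIntegrable (fun u => dens m i u * Real.log (1-u)) volume 0 1 :=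
  log_ii.continuousOn_mul (dens_cont m i).continuousOn

lemma ii_unif (f : ℝ → ℝ) (hf : IntervalIntegrable f volume 0 1) : Integrable f unif := by
  have := (intervalIntegrable_iff_integrableOn_Ioo_of_le zero_le_one).1 hf
  exact this

lemma integral_unif (f : ℝ → ℝ) : ∫ u, f u ∂unif = ∫ u in (0:ℝ)..1, f u := by
  rw [intervalIntegral.integral_of_le zero_le_one, integral_Ioc_eq_integral_Ioo]; rfl

lemma dens_logdens (m i : ℕ) (hi : i ≤ m) :
    (fun u => dens m i u * Real.log (dens m i u)) =ᵐ[unif]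
    (fun u => dens m i u * Real.log ((m+1) * m.choose i) + i * (dens m i u * Real.log u) +
      (m-i : ℕ) * (dens m i u * Real.log (1-u))) := by
  filter_upwards [unif_ae] with u hu
  rw [log_dens m i hi u hu]; ring

lemma os_log (m : ℕ) (i : Fin (m+1)) :
    Integrable (fun u => Real.log (dens m i u)) (osLaw (m+1) unif i) ∧
    ∫ u, Real.log (dens m i u) ∂(osLaw (m+1) unif i) =
      Real.log ((m+1) * m.choose i) + i * ((harmonic i : ℝ) - harmonic (m+1)) +
      (m-i : ℕ) * ((harmonic (m-i) : ℝ) - harmonic (m+1)) := by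
  have hi : (i:ℕ) ≤ m := by omega
  have e : ∀ᵐ u ∂unif, (ENNReal.ofReal (dens m i u)).toReal • Real.log (dens m i u) = dens m i u * Real.log (dens m i u) := by
    filter_upwards [unif_ae] with u hu
    rw [ENNReal.toReal_ofReal (dens_pos m i hi u hu).le, smul_eq_mul]
  have I1 := ii_unif _ (((dens_cont m i).mul_const (Real.log ((m+1) * m.choose i))).intervalIntegrable 0 1)
  have I2 := (ii_unif _ (dens_log_int m i)).const_mul (i : ℝ)
  have I3 := (ii_unif _ (dens_log_int' m i)).const_mul ((m-i : ℕ) : ℝ)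
  rw [os_eq]
  constructor
  · rw [integrable_withDensity_iff_integrable_smul' (dens_meas m i) (by simp)]
    exact (((I1.add I2).add I3).congr (dens_logdens m i hi).symm).congr (EventuallyEq.symm e)
  · rw [integral_withDensity_eq_integral_toReal_smul (dens_meas m i) (by simp),
      integral_congr_ae e, integral_congr_ae (dens_logdens m i hi)]
    have I12 := I1.add I2
    rw [integral_add (by exact I12) I3, integral_add I1 I2, integral_mul_const, integral_const_mul, integral_const_mul,
      integral_unif, integral_unif, integral_unif, dens_integral m i hi, tailB_one m i hi,
      dens_log m i hi, dens_log' m i hi, one_mul]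

lemma klDiv_eq (m : ℕ) :
    klDiv ((sampleLaw (m+1) unif).map sortTuple)
      (Measure.pi fun i : Fin (m+1) => osLaw (m+1) unif i)
      = ((Real.log (m+1).factorial - ∑ i : Fin (m+1), ∫ u, Real.log (dens m i u) ∂(osLaw (m+1) unif i) : ℝ) : EReal) := by
  have hmap : ∀ i : Fin (m+1), ((sampleLaw (m+1) unif).map sortTuple).map (fun x => x i) = osLaw (m+1) unif i := by
    intro i
    rw [Measure.map_map (measurable_pi_apply i) measurable_sort]; rfl
  have hQ : (Measure.pi fun i : Fin (m+1) => osLaw (m+1) unif i) =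
      (sampleLaw (m+1) unif).withDensity (fun x => ∏ i : Fin (m+1), ENNReal.ofReal (dens m i (x i))) := by
    simp_rw [os_eq]
    exact pi_dens (m+1) (fun i u => ENNReal.ofReal (dens m i u)) (fun i => dens_meas m i)
  have hqm : Measurable (fun x : Fin (m+1) → ℝ => ∏ i : Fin (m+1), ENNReal.ofReal (dens m i (x i))) :=
    Finset.measurable_prod _ fun i _ => (dens_meas m i).comp (measurable_pi_apply i)
  have hsupp : ∀ᵐ x ∂(sampleLaw (m+1) unif), ∀ i, x i ∈ Set.Ioo (0:ℝ) 1 := by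
    rw [eventually_all]
    intro i
    exact (measurePreserving_eval (fun _ : Fin (m+1) => unif) i).quasiMeasurePreserving.ae unif_ae
  have hq0 : ∀ᵐ x ∂(sampleLaw (m+1) unif), ∏ i : Fin (m+1), ENNReal.ofReal (dens m i (x i)) ≠ 0 := by
    filter_upwards [hsupp] with x hx
    rw [Finset.prod_ne_zero_iff]
    intro i _
    simpa using dens_pos m i (by omega) _ (hx i)
  have hqt : ∀ x : Fin (m+1) → ℝ, ∏ i : Fin (m+1), ENNReal.ofReal (dens m i (x i)) ≠ ⊤ :=
    fun x => ENNReal.prod_ne_top fun i _ => ENNReal.ofReal_ne_top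
  have hpm : Measurable ((monoSet (m+1)).indicator fun _ => ((m+1).factorial : ENNReal)) :=
    measurable_const.indicator (monoSet_meas _)
  have hPl : (sampleLaw (m+1) unif).map sortTuple ≪ sampleLaw (m+1) unif := by
    rw [joint_eq]; exact withDensity_absolutelyContinuous _ _
  have hac : (sampleLaw (m+1) unif).map sortTuple ≪
      (Measure.pi fun i : Fin (m+1) => osLaw (m+1) unif i) := by
    rw [hQ]
    exact hPl.trans (withDensity_absolutelyContinuous' hqm.aemeasurable hq0)
  have hPp : IsProbabilityMeasure ((sampleLaw (m+1) unif).map sortTuple) :=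
    Measure.isProbabilityMeasure_map measurable_sort.aemeasurable
  have hrn : ∀ᵐ x ∂((sampleLaw (m+1) unif).map sortTuple),
      Real.log ((((sampleLaw (m+1) unif).map sortTuple).rnDeriv
        (Measure.pi fun i : Fin (m+1) => osLaw (m+1) unif i) x).toReal) =
      Real.log (m+1).factorial - ∑ i : Fin (m+1), Real.log (dens m i (x i)) := by
    have r1 := Measure.rnDeriv_withDensity_right ((sampleLaw (m+1) unif).map sortTuple)
      (sampleLaw (m+1) unif) hqm.aemeasurable hq0 (Eventually.of_forall hqt)
    have r2 := Measure.rnDeriv_withDensity (sampleLaw (m+1) unif) hpm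
    rw [← joint_eq] at r2
    rw [← hQ] at r1
    have hmono : ∀ᵐ x ∂((sampleLaw (m+1) unif).map sortTuple), x ∈ monoSet (m+1) := by
      refine (ae_map_iff (p := fun x => x ∈ monoSet (m+1)) measurable_sort.aemeasurable (monoSet_meas (m+1))).2 ?_
      exact Eventually.of_forall fun x => Tuple.monotone_sort x
    filter_upwards [hPl.ae_le r1, hPl.ae_le r2, hPl.ae_le hsupp, hmono] with x h1 h2 h3 h4
    rw [h1, h2, Set.indicator_of_mem h4, ENNReal.toReal_mul, ENNReal.toReal_inv, ENNReal.toReal_prod,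
      ENNReal.toReal_natCast]
    have hd : ∀ i : Fin (m+1), 0 < dens m i (x i) := fun i => dens_pos m i (by omega) _ (h3 i)
    simp_rw [ENNReal.toReal_ofReal (hd _).le]
    have hp : 0 < ∏ i : Fin (m+1), dens m i (x i) := Finset.prod_pos fun i _ => hd i
    have hf : ((m+1).factorial : ℝ) ≠ 0 := by exact_mod_cast (Nat.factorial_pos _).ne'
    rw [Real.log_mul (inv_ne_zero hp.ne') hf, Real.log_inv, Real.log_prod (fun i _ => (hd i).ne')]
    ring
  rw [klDiv, if_pos hac, integral_congr_ae hrn]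
  have hlm : ∀ i : Fin (m+1), Measurable (fun u => Real.log (dens m i u)) :=
    fun i => Real.measurable_log.comp (dens_cont m i).measurable
  have hI : ∀ i : Fin (m+1), Integrable (fun x : Fin (m+1) → ℝ => Real.log (dens m i (x i)))
      ((sampleLaw (m+1) unif).map sortTuple) := by
    intro i
    have := (os_log m i).1
    rw [← hmap i] at this
    exact this.comp_measurable (measurable_pi_apply i)
  rw [integral_sub (integrable_const _) (integrable_finsetSum _ fun i _ => hI i), integral_finsetSum _ fun i _ => hI i]
  simp only [integral_const, probReal_univ, one_smul]
  congr 3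
  ext i
  rw [← hmap i, integral_map (measurable_pi_apply i).aemeasurable (hlm i).aestronglyMeasurable]

lemma arith (m : ℕ) :
    Real.log (m+1).factorial - ∑ i : Fin (m+1), (Real.log ((m+1) * m.choose i) + i * ((harmonic i : ℝ) - harmonic (m+1)) +
      (m-i : ℕ) * ((harmonic (m-i) : ℝ) - harmonic (m+1)))
    = 2 * (∑ t ∈ Finset.Icc 2 (m+1), T (t - 1)) - (((m+1 : ℕ) : ℝ) - 1) * T (m+1) := by
  have h1 : ∑ t ∈ Finset.Icc 2 (m+1), T (t - 1) = ∑ i ∈ Finset.range (m+1), T i := by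
    rw [Finset.sum_range_succ', show T 0 = 0 by simp [T], add_zero]
    rw [show Finset.Icc 2 (m+1) = Finset.Ico 2 (m+2) from rfl, Finset.sum_Ico_eq_sum_range]
    refine Finset.sum_congr (by congr 1) fun k _ => ?_
    congr 1; omega
  have h2 : ∀ i ∈ Finset.range (m+1), (Real.log ((m+1) * m.choose i) + i * ((harmonic i : ℝ) - harmonic (m+1)) +
      (m-i : ℕ) * ((harmonic (m-i) : ℝ) - harmonic (m+1))) =
      (Real.log (m+1).factorial - m * harmonic (m+1)) - T i - T (m - i) := by
    intro i hi
    have hi : i ≤ m := by rw [Finset.mem_range] at hi; omega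
    have hf : ((m+1).factorial : ℝ) = ((m+1) * m.choose i) * i.factorial * (m-i).factorial := by
      rw [Nat.factorial_succ, ← Nat.choose_mul_factorial_mul_factorial hi]
      push_cast; ring
    have hc : (m.choose i : ℝ) ≠ 0 := by exact_mod_cast (Nat.choose_pos hi).ne'
    have hf1 : (i.factorial : ℝ) ≠ 0 := by exact_mod_cast (Nat.factorial_pos _).ne'
    have hf2 : ((m-i).factorial : ℝ) ≠ 0 := by exact_mod_cast (Nat.factorial_pos _).ne'
    have hm : (m:ℝ)+1 ≠ 0 := by positivity
    rw [hf, Real.log_mul (by positivity) hf2, Real.log_mul (by positivity) hf1, T, T,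
      Nat.cast_sub hi]
    ring
  rw [Fin.sum_univ_eq_sum_range (fun i => (Real.log ((m+1) * m.choose i) + i * ((harmonic i : ℝ) - harmonic (m+1)) +
      (m-i : ℕ) * ((harmonic (m-i) : ℝ) - harmonic (m+1)))) (m+1), Finset.sum_congr rfl h2,
    Finset.sum_sub_distrib, Finset.sum_sub_distrib]
  have h3 : ∑ i ∈ Finset.range (m+1), T (m - i) = ∑ i ∈ Finset.range (m+1), T i := by
    have := Finset.sum_range_reflect T (m+1)
    simpa using this
  rw [h1, h3, Finset.sum_const, Finset.card_range, nsmul_eq_mul, T]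
  push_cast
  ring

/-- KL divergence between the joint law of the whole ordered uniform sample and the
product of the marginal laws of the order statistics. -/
theorem kl_uniform_orderStatistics_whole
    (n : ℕ) (hn : 0 < n) :
    klDiv ((sampleLaw n unif).map sortTuple)
      (Measure.pi fun i : Fin n => osLaw n unif i)
      = ((2 * (∑ t ∈ Finset.Icc 2 n, T (t - 1)) - ((n : ℝ) - 1) * T n : ℝ) : EReal) := by
  obtain ⟨m, rfl⟩ : ∃ m, n = m + 1 := ⟨n - 1, by omega⟩
  rw [klDiv_eq, ← arith]
  congr 2
  exact Finset.sum_congr rfl fun i _ => (os_log m i).2
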